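/- Let φ₁ and φ₂ be idempotent states on a finite quantum group A. If there exists a real number λ > 0 such that φ₁(a* a) ≤ λ·φ₂(a* a) for all a ∈ A (i.e. the functional λφ₂ − φ₁ is positive), then φ₁ ⋆ φ₂ = φ₂. -/

import Mathlib

open TensorProduct HopfAlgebra
open scoped ComplexOrder

noncomputable section

variable {A : Type*} [Ring A] [StarRing A] [HopfAlgebra ℂ A]
  [StarModule ℂ A] [FiniteDimensional ℂ A]

/-- Convolution of linear functionals on a coalgebra: `φ ⋆ ψ := (φ ⊗ ψ) ∘ Δ`. -/
def conv (φ ψ : A →ₗ[ℂ] ℂ) : A →ₗ[ℂ] ℂ :=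
  LinearMap.mul' ℂ ℂ ∘ₗ TensorProduct.map φ ψ ∘ₗ Coalgebra.comul

/-- A state: a unital positive linear functional. -/
def IsState (φ : A →ₗ[ℂ] ℂ) : Prop :=
  φ 1 = 1 ∧ ∀ a : A, 0 ≤ φ (star a * a)

/-- An idempotent state: a state satisfying `φ ⋆ φ = φ`. -/
def IsIdempotentState (φ : A →ₗ[ℂ] ℂ) : Prop :=
  IsState φ ∧ conv φ φ = φ

/-- The Haar state axioms: a faithful state which is a trace and two-sided invariant,
`(h ⊗ id)(Δ a) = h(a)·1 = (id ⊗ h)(Δ a)`. -/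
structure IsHaarState (h : A →ₗ[ℂ] ℂ) : Prop where
  state : IsState h
  faithful : ∀ a : A, h (star a * a) = 0 → a = 0
  left_inv : ∀ a : A,
    TensorProduct.lid ℂ A (TensorProduct.map h LinearMap.id (Coalgebra.comul a)) = h a • 1
  right_inv : ∀ a : A,
    TensorProduct.rid ℂ A (TensorProduct.map LinearMap.id h (Coalgebra.comul a)) = h a • 1
  trace : ∀ a b : A, h (a * b) = h (b * a)

/-- The star-compatibility axioms of a finite quantum group (finite-dimensional Hopf
`*`-algebra): the comultiplication is `*`-preserving (with respect to the entrywise star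
`tstar` on `A ⊗ A`, given as data), and the antipode is `*`-preserving and involutive. -/
structure StarAxioms (tstar : A ⊗[ℂ] A →+ A ⊗[ℂ] A) : Prop where
  tstar_tmul : ∀ a b : A, tstar (a ⊗ₜ[ℂ] b) = star a ⊗ₜ[ℂ] star b
  comul_star : ∀ a : A, Coalgebra.comul (R := ℂ) (star a) = tstar (Coalgebra.comul a)
  antipode_star : ∀ a : A, antipode (R := ℂ) (star a) = star (antipode (R := ℂ) a)
  antipode_invol : ∀ a : A, antipode (R := ℂ) (antipode (R := ℂ) a) = a

/-- A group-like projection: a nonzero self-adjoint idempotent `p` with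
`Δ(p)(1 ⊗ p) = p ⊗ p`. -/
def IsGroupLikeProjection (p : A) : Prop :=
  p ≠ 0 ∧ star p = p ∧ p * p = p ∧
    Coalgebra.comul (R := ℂ) p * ((1 : A) ⊗ₜ[ℂ] p) = p ⊗ₜ[ℂ] p

namespace FiniteQuantumGroup

section PositiveFunctional

variable {B : Type*} [Ring B] [StarRing B] [Algebra ℂ B] [StarModule ℂ B]

/-- If a functional is nonnegative on `star b * b` and vanishes on `star x * x`, then it vanishes
on `y * x` for all `y` (a case of the Cauchy–Schwarz inequality). -/
theorem map_mul_eq_zero_of_map_star_mul_self {f : B →ₗ[ℂ] ℂ}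
    (hf : ∀ b, 0 ≤ f (star b * b)) {x : B} (hx : f (star x * x) = 0) (y : B) :
    f (y * x) = 0 := by
  have key (t : ℂ) : 0 ≤ f (y * star y) + t * f (y * x) + star t * f (star x * star y) := by
    have := hf (star y + t • x)
    simp only [star_add, star_star, star_smul, mul_add, add_mul, map_add, smul_mul_assoc,
      mul_smul_comm, map_smul, smul_eq_mul, hx, mul_zero, add_zero] at this
    convert this using 1
    ring
  have hN : 0 ≤ f (y * star y) := by simpa using hf (star y)
  set N := f (y * star y)
  set q := f (y * x)
  set r := f (star x * star y)
  have hNim : N.im = 0 := (Complex.nonneg_iff.1 hN).2.symm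
  have hre (s : ℝ) : 0 ≤ N.re + s * (q.re + r.re) ∧ q.im + r.im = 0 := by
    have h₁ := Complex.nonneg_iff.1 (key s)
    have h₂ := Complex.nonneg_iff.1 (key 1)
    simp at h₁ h₂
    constructor <;> linarith
  have him (s : ℝ) : 0 ≤ N.re + s * (r.im - q.im) ∧ q.re - r.re = 0 := by
    have h₁ := Complex.nonneg_iff.1 (key (s * Complex.I))
    have h₂ := Complex.nonneg_iff.1 (key Complex.I)
    simp at h₁ h₂
    constructor <;> linarith
  have vanish (c : ℝ) (hc : ∀ s : ℝ, 0 ≤ N.re + s * c) : c = 0 := by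
    by_contra h0
    have := hc (-(N.re + 1) / c)
    rw [div_mul_cancel₀ _ h0] at this
    linarith
  have h₁ := vanish _ fun s ↦ (hre s).1
  have h₂ := vanish _ fun s ↦ (him s).1
  have h₃ := (hre 0).2
  have h₄ := (him 0).2
  apply Complex.ext <;> simp <;> linarith

/-- A functional that is nonnegative on `star b * b` is hermitian. -/
theorem map_star_of_nonneg {f : B →ₗ[ℂ] ℂ} (hf : ∀ b, 0 ≤ f (star b * b)) (b : B) :
    f (star b) = star (f b) := by
  have key (t : ℂ) : (t * f b + star t * f (star b)).im = 0 := by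
    have h₀ := (Complex.nonneg_iff.1 (hf (1 + t • b))).2
    have h₁ : (f 1).im = 0 := by simpa using (Complex.nonneg_iff.1 (hf 1)).2.symm
    have h₂ : (f ((t • star t) • (star b * b))).im = 0 := by
      have := (Complex.nonneg_iff.1 (hf (t • b))).2
      simpa [star_smul, smul_smul, mul_comm] using this.symm
    have expand : star (1 + t • b) * (1 + t • b) =
        1 + t • b + star t • star b + (t • star t) • (star b * b) := by
      simp only [star_add, star_one, star_smul, mul_add, add_mul, one_mul, mul_one,
        smul_mul_assoc, mul_smul_comm, smul_add, smul_assoc]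
      abel
    rw [expand] at h₀
    simp only [map_add, Complex.add_im, h₁, h₂] at h₀
    simp only [map_smul, smul_eq_mul] at h₀
    rw [Complex.add_im]
    linarith
  have h₁ := key 1
  have h₂ := key Complex.I
  simp at h₁ h₂
  apply Complex.ext <;> simp <;> linarith

/-- The Gram matrix of a family with respect to a positive functional is positive semidefinite. -/
theorem posSemidef_gram {f : B →ₗ[ℂ] ℂ} (hf : ∀ b, 0 ≤ f (star b * b)) {ι : Type*} [Fintype ι]
    (v : ι → B) : (Matrix.of fun i j ↦ f (star (v i) * v j)).PosSemidef := by
  rw [Matrix.posSemidef_iff_dotProduct_mulVec]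
  refine ⟨?_, fun x ↦ ?_⟩
  · ext i j
    simp [Matrix.conjTranspose_apply, ← map_star_of_nonneg hf]
  · convert hf (∑ i, x i • v i) using 1
    simp [dotProduct, Matrix.mulVec, star_sum, Finset.sum_mul, Finset.mul_sum, star_smul]
    rw [Finset.sum_comm]
    exact Finset.sum_congr rfl fun i _ ↦ Finset.sum_congr rfl fun j _ ↦ by ring

end PositiveFunctional

section TensorFunctional

variable {B C : Type*} [Ring B] [Algebra ℂ B] [Ring C] [Algebra ℂ C]

/-- The functional `φ ⊗ ψ` on `B ⊗ C`. -/
def tensorFunctional (φ : B →ₗ[ℂ] ℂ) (ψ : C →ₗ[ℂ] ℂ) : B ⊗[ℂ] C →ₗ[ℂ] ℂ :=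
  LinearMap.mul' ℂ ℂ ∘ₗ TensorProduct.map φ ψ

@[simp]
theorem tensorFunctional_tmul (φ : B →ₗ[ℂ] ℂ) (ψ : C →ₗ[ℂ] ℂ) (b : B) (c : C) :
    tensorFunctional φ ψ (b ⊗ₜ c) = φ b * ψ c := by
  simp [tensorFunctional]

/-- The slice map `id ⊗ ψ`. -/
def sliceRight (ψ : C →ₗ[ℂ] ℂ) : B ⊗[ℂ] C →ₗ[ℂ] B :=
  (TensorProduct.rid ℂ B).toLinearMap ∘ₗ ψ.lTensor B

@[simp]
theorem sliceRight_tmul (ψ : C →ₗ[ℂ] ℂ) (b : B) (c : C) :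
    sliceRight ψ (b ⊗ₜ[ℂ] c) = ψ c • b := by
  simp [sliceRight]

theorem tensorFunctional_tmul_one_mul (φ : B →ₗ[ℂ] ℂ) (ψ : C →ₗ[ℂ] ℂ) (b : B) (x : B ⊗[ℂ] C) :
    tensorFunctional φ ψ ((b ⊗ₜ 1) * x) = φ (b * sliceRight ψ x) := by
  induction x with
  | zero => simp
  | tmul b' c => simp [mul_comm]
  | add x y hx hy => simp [mul_add, hx, hy]

theorem tensorFunctional_mul_tmul_one (φ : B →ₗ[ℂ] ℂ) (ψ : C →ₗ[ℂ] ℂ) (b : B) (x : B ⊗[ℂ] C) :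
    tensorFunctional φ ψ (x * (b ⊗ₜ 1)) = φ (sliceRight ψ x * b) := by
  induction x with
  | zero => simp
  | tmul b' c => simp [mul_comm]
  | add x y hx hy => simp [add_mul, hx, hy]

variable [StarRing B] [StarModule ℂ B] [StarRing C] [StarModule ℂ C]

/-- The tensor product of two positive functionals is positive. -/
theorem tensorFunctional_star_mul_self_nonneg {φ : B →ₗ[ℂ] ℂ} {ψ : C →ₗ[ℂ] ℂ}
    (hφ : ∀ b, 0 ≤ φ (star b * b)) (hψ : ∀ c, 0 ≤ ψ (star c * c)) (x : B ⊗[ℂ] C) :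
    0 ≤ tensorFunctional φ ψ (star x * x) := by
  obtain ⟨S, rfl⟩ := TensorProduct.exists_finset (R := ℂ) x
  rw [← Finset.sum_coe_sort]
  have h := ((posSemidef_gram hφ fun i : S ↦ i.1.1).hadamard
    (posSemidef_gram hψ fun i : S ↦ i.1.2)).dotProduct_mulVec_nonneg 1
  convert h using 1
  simp [dotProduct, Matrix.mulVec, Finset.sum_mul, Finset.mul_sum, star_sum]
  rw [Finset.sum_comm]

theorem sliceRight_star {ψ : C →ₗ[ℂ] ℂ} (hψ : ∀ c, ψ (star c) = star (ψ c)) (x : B ⊗[ℂ] C) :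
    sliceRight ψ (star x) = star (sliceRight ψ x) := by
  induction x with
  | zero => simp
  | tmul b c => simp [TensorProduct.star_tmul, hψ, star_smul]
  | add x y hx hy => simp [hx, hy]

end TensorFunctional

section Hopf

variable {H : Type*} [Ring H] [HopfAlgebra ℂ H]

/-- The convolution operator `a ↦ (id ⊗ φ)(Δ a)`. -/
def convOperator (φ : H →ₗ[ℂ] ℂ) : H →ₗ[ℂ] H :=
  (TensorProduct.rid ℂ H).toLinearMap ∘ₗ φ.lTensor H ∘ₗ Coalgebra.comul

theorem convOperator_convOperator (φ ψ : H →ₗ[ℂ] ℂ) (a : H) :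
    convOperator φ (convOperator ψ a) = convOperator (conv φ ψ) a := by
  have key (x : H ⊗[ℂ] H) :
      convOperator φ (TensorProduct.rid ℂ H (ψ.lTensor H x)) =
        TensorProduct.rid ℂ H ((LinearMap.mul' ℂ ℂ ∘ₗ TensorProduct.map φ ψ).lTensor H
          (TensorProduct.assoc ℂ H H H (Coalgebra.comul.rTensor H x))) := by
    induction x with
    | zero => simp
    | add x y hx hy => simp only [map_add, hx, hy]
    | tmul b c =>
      simp only [LinearMap.lTensor_tmul, TensorProduct.rid_tmul, map_smul, convOperator,
        LinearMap.comp_apply, LinearMap.rTensor_tmul, LinearEquiv.coe_coe]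
      generalize Coalgebra.comul (R := ℂ) b = y
      induction y with
      | zero => simp
      | add x y hx hy => simp only [map_add, smul_add, TensorProduct.add_tmul, hx, hy]
      | tmul b d => simp [smul_smul, mul_comm]
  have h := key (Coalgebra.comul a)
  rw [Coalgebra.coassoc_apply, ← LinearMap.lTensor_comp_apply] at h
  exact h

theorem mul_map_antipode_convOperator_comul (χ : H →ₗ[ℂ] ℂ) (a : H) :
    LinearMap.mul' ℂ H (TensorProduct.map (antipode ℂ) (convOperator χ) (Coalgebra.comul a)) =
      χ a • 1 := by
  have hc : WithConv.toConv (convOperator χ) =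
      WithConv.toConv LinearMap.id * WithConv.toConv (Algebra.linearMap ℂ H ∘ₗ χ) := by
    rw [LinearMap.convMul_def]
    congr 1
    simp only [convOperator, ← LinearMap.comp_assoc]
    congr 1
    ext b c
    simp [Algebra.smul_def, Algebra.commutes]
  have h : WithConv.toConv (antipode ℂ) * WithConv.toConv (convOperator χ) =
      WithConv.toConv (Algebra.linearMap ℂ H ∘ₗ χ) := by
    rw [hc, ← mul_assoc, LinearMap.antipode_mul_id, one_mul]
  have := congr(($h).ofConv a)
  simpa [LinearMap.convMul_def, Algebra.algebraMap_eq_smul_one] using this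

/-- A functional `χ` vanishes if `φ (c * (id ⊗ χ)(Δ a)) = 0` for all `c`, `a`, where `φ 1 = 1`. -/
theorem eq_zero_of_map_mul_convOperator {φ χ : H →ₗ[ℂ] ℂ} (hφ : φ 1 = 1)
    (h : ∀ c a, φ (c * convOperator χ a) = 0) : χ = 0 := by
  ext d
  have hz : φ ∘ₗ LinearMap.mul' ℂ H ∘ₗ TensorProduct.map (antipode ℂ) (convOperator χ) = 0 := by
    ext b c
    simp [h]
  simpa [mul_map_antipode_convOperator_comul, hφ] using congr($hz (Coalgebra.comul d))

end Hopf

end FiniteQuantumGroup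

open FiniteQuantumGroup

/-- If `φ₁ ≤ λ·φ₂` (as positive functionals) for some `λ > 0`, then `φ₁ ⋆ φ₂ = φ₂`. -/
theorem conv_eq_of_le_smul
    (h : A →ₗ[ℂ] ℂ) (hh : IsHaarState h)
    (tstar : A ⊗[ℂ] A →+ A ⊗[ℂ] A) (hstar : StarAxioms tstar)
    (φ₁ φ₂ : A →ₗ[ℂ] ℂ)
    (hφ₁ : IsIdempotentState φ₁) (hφ₂ : IsIdempotentState φ₂)
    (l : ℝ) (hl : 0 < l)
    (hle : ∀ a : A, φ₁ (star a * a) ≤ (l : ℂ) * φ₂ (star a * a)) :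
    conv φ₁ φ₂ = φ₂ := by
  have hcs (a : A) : Coalgebra.comul (R := ℂ) (star a) = star (Coalgebra.comul (R := ℂ) a) := by
    rw [hstar.comul_star]
    induction Coalgebra.comul (R := ℂ) a with
    | zero => simp
    | tmul b c => rw [hstar.tstar_tmul, TensorProduct.star_tmul]
    | add x y hx hy => simp [hx, hy]
  obtain ⟨⟨hone₁, hp₁⟩, -⟩ := hφ₁
  obtain ⟨⟨hone₂, hp₂⟩, hid⟩ := hφ₂
  rw [← sub_eq_zero]
  refine eq_zero_of_map_mul_convOperator hone₂ fun c a ↦ ?_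
  set b := convOperator φ₂ a with hb
  have hbb : convOperator φ₂ b = b := by rw [hb, convOperator_convOperator, hid]
  have hslice (ψ : A →ₗ[ℂ] ℂ) (x : A) :
      sliceRight ψ (Coalgebra.comul (R := ℂ) x) = convOperator ψ x := rfl
  have hcomul (x : A) : tensorFunctional φ₂ φ₂ (Coalgebra.comul x) = φ₂ x := congr($hid x)
  set X : A ⊗[ℂ] A := Coalgebra.comul b - b ⊗ₜ 1 with hX
  have hX₂ : tensorFunctional φ₂ φ₂ (star X * X) = 0 := by
    have hstarX : star X = Coalgebra.comul (star b) - star b ⊗ₜ 1 := by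
      rw [hX, star_sub, hcs, TensorProduct.star_tmul, star_one]
    have hbs : convOperator φ₂ (star b) = star b := by
      rw [← hslice, hcs, sliceRight_star (map_star_of_nonneg hp₂), hslice, hbb]
    rw [hstarX, hX, sub_mul, mul_sub, mul_sub, ← Bialgebra.comul_mul]
    simp only [map_sub, tensorFunctional_tmul_one_mul, tensorFunctional_mul_tmul_one, hcomul,
      hslice, hbb, hbs, sliceRight_tmul, hone₂, one_smul, sub_self]
  have hX₁ : tensorFunctional φ₂ φ₁ (star X * X) = 0 := by
    refine le_antisymm ?_ (tensorFunctional_star_mul_self_nonneg hp₂ hp₁ X)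
    have hdiff : ∀ x : A, 0 ≤ ((l : ℂ) • φ₂ - φ₁) (star x * x) := fun x ↦ by
      simpa using hle x
    have := tensorFunctional_star_mul_self_nonneg hp₂ hdiff X
    have hlin : tensorFunctional φ₂ ((l : ℂ) • φ₂ - φ₁) =
        (l : ℂ) • tensorFunctional φ₂ φ₂ - tensorFunctional φ₂ φ₁ := by
      ext x y
      simp [mul_sub, mul_left_comm]
    rw [hlin, LinearMap.sub_apply, LinearMap.smul_apply, hX₂, smul_zero, zero_sub] at this
    exact neg_nonneg.1 this
  have hzero := map_mul_eq_zero_of_map_star_mul_self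
    (tensorFunctional_star_mul_self_nonneg hp₂ hp₁) hX₁ (c ⊗ₜ 1)
  rw [tensorFunctional_tmul_one_mul, hX, map_sub, hslice, sliceRight_tmul, hb,
    convOperator_convOperator, hone₁, one_smul] at hzero
  have hsub : convOperator (conv φ₁ φ₂ - φ₂) =
      convOperator (conv φ₁ φ₂) - convOperator φ₂ := by
    simp [convOperator, LinearMap.lTensor_sub, LinearMap.sub_comp, LinearMap.comp_sub]
  rw [hsub, LinearMap.sub_apply, hzero]
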